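/- (Peaking Lemma) Let f be a minmax monotone cost function on a finite tree T_in, 𝒯 ≥ 0, T = (V,E) a working subtree with sink set S = S_out ∩ V, and let (S_out, P_out) be a partial sink configuration that is optimal relative to T. Suppose the ordered pair (u,v) satisfies the peaking criterion. Then the configuration obtained by adding u to S_out with block P_u := V_{-v}(u), and replacing the working tree by the subtree of T induced on (V \ V_{-v}(u)) ∪ {u} (in which u is a leaf), is again a partial sink configuration that is optimal relative to the new working tree. -/

import Mathlib

open SimpleGraph Set
open scoped ENNReal

variable {V : Type*}

/-- The vertex set of the connected component of the subgraph of `G` induced on `A`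
containing the vertex `u` (empty if `u ∉ A`). -/
def reachSet (G : SimpleGraph V) (A : Set V) (u : V) : Set V :=
  {y | ∃ (hu : u ∈ A) (hy : y ∈ A), (G.induce A).Reachable ⟨u, hu⟩ ⟨y, hy⟩}

/-- `U` is a subtree: the induced subgraph on `U` is connected. -/
def IsSubtree (G : SimpleGraph V) (U : Set V) : Prop :=
  (G.induce U).Connected

/-- A minmax monotone cost function on the tree `G`:
`f {s} s = 0`; `f U s = ∞` if `U` is not a subtree or `s ∉ U`; set monotonicity;
path monotonicity; and max tree composition (the slices of `U` defined by `s` being the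
connected components of `U \ {s}`). -/
structure IsMinmaxMonotone (G : SimpleGraph V) (f : Set V → V → ℝ≥0∞) : Prop where
  singleton_eq_zero : ∀ s : V, f {s} s = 0
  eq_top_of_not_subtree : ∀ (U : Set V) (s : V), ¬ IsSubtree G U → f U s = ⊤
  eq_top_of_not_mem : ∀ (U : Set V) (s : V), s ∉ U → f U s = ⊤
  set_mono : ∀ (U₁ U₂ : Set V) (s : V), IsSubtree G U₁ → IsSubtree G U₂ →
    s ∈ U₁ → U₁ ⊆ U₂ → f U₁ s ≤ f U₂ s
  path_mono : ∀ (U : Set V) (s u : V), IsSubtree G U → s ∉ U → u ∈ U → G.Adj s u →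
    f U u ≤ f (U ∪ {s}) s
  max_comp : ∀ (U : Set V) (s : V), IsSubtree G U → s ∈ U →
    f U s = ⨆ x ∈ U \ {s}, f (reachSet G (U \ {s}) x ∪ {s}) s

/-- `s` is a leaf of the (working) tree induced on `W`. -/
def IsLeafOf (G : SimpleGraph V) (W : Set V) (s : V) : Prop :=
  s ∈ W ∧ ∃! u, u ∈ W ∧ G.Adj s u

/-- The ordered pair `(u,v)` satisfies the peaking criterion in the working tree on `W`
with sink set `S` and threshold `𝒯`. -/
def PeakingPair (G : SimpleGraph V) (f : Set V → V → ℝ≥0∞) (𝒯 : ℝ≥0∞)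
    (W S : Set V) (u v : V) : Prop :=
  u ∈ W ∧ v ∈ W ∧ G.Adj u v ∧ S ∩ reachSet G (W \ {v}) u = ∅ ∧
    f (reachSet G (W \ {v}) u) u ≤ 𝒯 ∧ 𝒯 < f (reachSet G (W \ {v}) u ∪ {v}) v

/-- `w` lies on the unique path from `a` to `b` in the tree induced on `W`. -/
def OnPath (G : SimpleGraph V) (W : Set V) (a b w : V) : Prop :=
  a ∈ W ∧ b ∈ W ∧ w ∈ W ∧ b ∉ reachSet G (W \ {w}) a

/-- Vertices of the hub tree: union of the paths from the sinks to the root `r`. -/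
def hubVerts (G : SimpleGraph V) (W S : Set V) (r : V) : Set V :=
  {w | ∃ s ∈ S, OnPath G W s r w}

/-- `r` is a valid root: a non-sink vertex of the working tree such that at least two of
the subtrees hanging off it contain sinks. -/
def GoodRoot (G : SimpleGraph V) (W S : Set V) (r : V) : Prop :=
  r ∈ W ∧ r ∉ S ∧
    ∃ η₁ η₂ : V, η₁ ≠ η₂ ∧ η₁ ∈ W ∧ η₂ ∈ W ∧ G.Adj r η₁ ∧ G.Adj r η₂ ∧
      (S ∩ reachSet G (W \ {r}) η₁).Nonempty ∧ (S ∩ reachSet G (W \ {r}) η₂).Nonempty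

/-- The working tree on `W` is RC-viable w.r.t. sinks `S` and root `r`: every outstanding
branch, together with the hub-tree node it is attached to, has cost at most `𝒯`. -/
def RCViable (G : SimpleGraph V) (f : Set V → V → ℝ≥0∞) (𝒯 : ℝ≥0∞)
    (W S : Set V) (r : V) : Prop :=
  ∀ w ∈ hubVerts G W S r, ∀ η ∈ W, G.Adj w η → η ∉ hubVerts G W S r →
    f (reachSet G (W \ {w}) η ∪ {w}) w ≤ 𝒯

/-- The set `A` is self-sufficient: it can be partitioned into subtree blocks, one for
each sink in `S ∩ A`, each block containing its sink and having cost at most `𝒯`. -/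
def SelfSufficient (G : SimpleGraph V) (f : Set V → V → ℝ≥0∞) (𝒯 : ℝ≥0∞)
    (S A : Set V) : Prop :=
  ∃ P : V → Set V,
    (⋃ s ∈ S ∩ A, P s) = A ∧
    (∀ s ∈ S ∩ A, IsSubtree G (P s) ∧ s ∈ P s ∧ f (P s) s ≤ 𝒯) ∧
    (S ∩ A).Pairwise fun s t => Disjoint (P s) (P t)

/-- The vertices of the path `Π(a,b)` in the tree induced on `W`. -/
def pathSet (G : SimpleGraph V) (W : Set V) (a b : V) : Set V :=
  {w | OnPath G W a b w}

/-- All vertices of outstanding branches attached to `w` (given hub-tree vertices `Hub`). -/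
def branchesAt (G : SimpleGraph V) (W Hub : Set V) (w : V) : Set V :=
  ⋃ η ∈ {η : V | η ∈ W ∧ G.Adj w η ∧ η ∉ Hub}, reachSet G (W \ {w}) η

/-- The bulk path `BP(a,b)`: the path `Π(a,b)` together with all outstanding branches
attached to its vertices. -/
def bulkPath (G : SimpleGraph V) (W S : Set V) (r a b : V) : Set V :=
  pathSet G W a b ∪ ⋃ w ∈ pathSet G W a b, branchesAt G W (hubVerts G W S r) w

/-- `v` is the parent of `u` in the hub tree rooted at `r`. -/
def HubParent (G : SimpleGraph V) (W S : Set V) (r u v : V) : Prop :=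
  u ∈ hubVerts G W S r ∧ v ∈ hubVerts G W S r ∧ G.Adj u v ∧ OnPath G W u r v

/-- The ordered pair `(u,v)` satisfies the reaching criterion: `v` is the hub-tree parent
of `u`, `T₋ᵥ(u)` is self-sufficient, and `BP(v,v) ∪ V₋ᵥ(u)` is not self-sufficient. -/
def ReachingPair (G : SimpleGraph V) (f : Set V → V → ℝ≥0∞) (𝒯 : ℝ≥0∞)
    (W S : Set V) (r u v : V) : Prop :=
  HubParent G W S r u v ∧
  SelfSufficient G f 𝒯 S (reachSet G (W \ {v}) u) ∧
  ¬ SelfSufficient G f 𝒯 S (bulkPath G W S r v v ∪ reachSet G (W \ {v}) u)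

/-- The vertex set `V(v)` of the subtree of the working tree (rooted at `r`) rooted at `v`:
all vertices whose path to the root passes through `v`. -/
def rootedBelow (G : SimpleGraph V) (W : Set V) (r v : V) : Set V :=
  {x | OnPath G W x r v}

/-- The rooted subtree `T(v)` is RC-viable: every outstanding branch attached to a
hub-tree node lying in `T(v)` has, together with its attachment node, cost at most `𝒯`. -/
def RCViableBelow (G : SimpleGraph V) (f : Set V → V → ℝ≥0∞) (𝒯 : ℝ≥0∞)
    (W S : Set V) (r v : V) : Prop :=
  ∀ w ∈ hubVerts G W S r ∩ rootedBelow G W r v, ∀ η ∈ W, G.Adj w η →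
    η ∉ hubVerts G W S r → f (reachSet G (W \ {w}) η ∪ {w}) w ≤ 𝒯

/-- The subtree with vertex set `A` (of the working tree rooted at `r`) is recursively
self-sufficient: for every hub-tree node `w` in `A`, the part of `A` lying below `w`
is self-sufficient. -/
def RecursivelySelfSufficientOn (G : SimpleGraph V) (f : Set V → V → ℝ≥0∞) (𝒯 : ℝ≥0∞)
    (W S : Set V) (r : V) (A : Set V) : Prop :=
  ∀ w ∈ hubVerts G W S r ∩ A, SelfSufficient G f 𝒯 S (rootedBelow G W r w ∩ A)

/-- A feasible sink configuration: a partition of all of `V_in` into subtree blocks,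
one per sink, each block containing exactly its own sink and having cost at most `𝒯`. -/
def IsFeasibleConfig (G : SimpleGraph V) (f : Set V → V → ℝ≥0∞) (𝒯 : ℝ≥0∞)
    (St : Set V) (P : V → Set V) : Prop :=
  (⋃ s ∈ St, P s) = Set.univ ∧
  St.Pairwise (fun s t => Disjoint (P s) (P t)) ∧
  ∀ s ∈ St, IsSubtree G (P s) ∧ St ∩ P s = {s} ∧ f (P s) s ≤ 𝒯

/-- An optimal feasible sink configuration: one with the minimum number of sinks. -/
def IsOptimalConfig (G : SimpleGraph V) (f : Set V → V → ℝ≥0∞) (𝒯 : ℝ≥0∞)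
    (St : Set V) (P : V → Set V) : Prop :=
  IsFeasibleConfig G f 𝒯 St P ∧
  ∀ (St' : Set V) (P' : V → Set V), IsFeasibleConfig G f 𝒯 St' P' → St.ncard ≤ St'.ncard

/-- A partial sink configuration relative to the working tree on `W`: pairwise disjoint
subtree blocks of cost at most `𝒯`, one per sink of `Sout`, covering `V_in \ (W \ Sout)`. -/
def IsPartialConfig (G : SimpleGraph V) (f : Set V → V → ℝ≥0∞) (𝒯 : ℝ≥0∞)
    (W : Set V) (Sout : Set V) (P : V → Set V) : Prop :=
  Sout.Pairwise (fun s t => Disjoint (P s) (P t)) ∧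
  (∀ s ∈ Sout, IsSubtree G (P s) ∧ s ∈ P s ∧ f (P s) s ≤ 𝒯) ∧
  (⋃ s ∈ Sout, P s) = Set.univ \ (W \ Sout)

/-- `(St, Pt)` is an optimal feasible sink configuration witnessing the optimality of the
partial configuration `(Sout, P)` relative to the working tree on `W` (conditions (C1)-(C3)). -/
def WitnessesOptimality (G : SimpleGraph V) (f : Set V → V → ℝ≥0∞) (𝒯 : ℝ≥0∞)
    (W : Set V) (Sout : Set V) (P : V → Set V) (St : Set V) (Pt : V → Set V) : Prop :=
  IsOptimalConfig G f 𝒯 St Pt ∧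
  Sout ⊆ St ∧
  St \ W = Sout \ W ∧
  (∀ s ∈ Sout ∩ W, IsLeafOf G W s) ∧
  (∀ s ∈ St, s ∉ W → Pt s = P s ∧ Pt s ∩ W = ∅) ∧
  (∀ s ∈ Sout ∩ W, P s ⊆ Pt s ∧ Pt s \ P s ⊆ W) ∧
  (∀ s ∈ St, s ∉ Sout → Pt s ⊆ W)

/-- The partial sink configuration `(Sout, P)` is optimal relative to the working tree on `W`. -/
def OptimalRelative (G : SimpleGraph V) (f : Set V → V → ℝ≥0∞) (𝒯 : ℝ≥0∞)
    (W : Set V) (Sout : Set V) (P : V → Set V) : Prop :=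
  ∃ (St : Set V) (Pt : V → Set V), WitnessesOptimality G f 𝒯 W Sout P St Pt

theorem mem_reachSet_iff_exists_walk {G : SimpleGraph V} {A : Set V} {u y : V} :
    y ∈ reachSet G A u ↔ ∃ p : G.Walk u y, ∀ z ∈ p.support, z ∈ A := by
  constructor
  · rintro ⟨hu, hy, ⟨p⟩⟩
    refine ⟨p.map (Embedding.induce A).toHom, fun z hz => ?_⟩
    obtain ⟨w, -, rfl⟩ := List.mem_map.1 (Walk.support_map _ p ▸ hz)
    exact w.2
  · rintro ⟨p, hp⟩
    exact ⟨hp _ p.start_mem_support, hp _ p.end_mem_support, ⟨p.induce A hp⟩⟩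

theorem exists_isPath_of_mem_reachSet {G : SimpleGraph V} {A : Set V} {u y : V}
    (h : y ∈ reachSet G A u) : ∃ p : G.Walk u y, p.IsPath ∧ ∀ z ∈ p.support, z ∈ A := by
  classical
  obtain ⟨p, hp⟩ := mem_reachSet_iff_exists_walk.1 h
  exact ⟨p.bypass, p.bypass_isPath, fun z hz => hp z (p.support_bypass_subset_support hz)⟩

theorem reachSet_subset {G : SimpleGraph V} {A : Set V} {u : V} : reachSet G A u ⊆ A :=
  fun _ h => h.2.1

theorem mem_reachSet_self {G : SimpleGraph V} {A : Set V} {u : V} (hu : u ∈ A) :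
    u ∈ reachSet G A u :=
  ⟨hu, hu, Reachable.refl _⟩

theorem mem_reachSet_symm {G : SimpleGraph V} {A : Set V} {x y : V}
    (h : y ∈ reachSet G A x) : x ∈ reachSet G A y := by
  obtain ⟨hx, hy, h⟩ := h
  exact ⟨hy, hx, h.symm⟩

theorem mem_reachSet_trans {G : SimpleGraph V} {A : Set V} {x y z : V}
    (h : y ∈ reachSet G A x) (h' : z ∈ reachSet G A y) : z ∈ reachSet G A x := by
  obtain ⟨hx, hy, h⟩ := h
  obtain ⟨_, hz, h'⟩ := h'
  exact ⟨hx, hz, h.trans h'⟩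

theorem mem_reachSet_of_adj {G : SimpleGraph V} {A : Set V} {x y : V}
    (hx : x ∈ A) (hy : y ∈ A) (h : G.Adj x y) : y ∈ reachSet G A x :=
  ⟨hx, hy, Adj.reachable (by simpa using h)⟩

theorem reachSet_mono {G : SimpleGraph V} {A B : Set V} (h : A ⊆ B) {u : V} :
    reachSet G A u ⊆ reachSet G B u := fun y hy => by
  obtain ⟨p, hp⟩ := mem_reachSet_iff_exists_walk.1 hy
  exact mem_reachSet_iff_exists_walk.2 ⟨p, fun z hz => h (hp z hz)⟩

theorem IsSubtree.mem_reachSet {G : SimpleGraph V} {U : Set V} (hU : IsSubtree G U) {x y : V}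
    (hx : x ∈ U) (hy : y ∈ U) : y ∈ reachSet G U x :=
  ⟨hx, hy, hU.preconnected _ _⟩

theorem isSubtree_of_forall_mem_reachSet {G : SimpleGraph V} {U : Set V} {c : V} (hc : c ∈ U)
    (h : ∀ x ∈ U, c ∈ reachSet G U x) : IsSubtree G U :=
  (connected_iff_exists_forall_reachable _).2
    ⟨⟨c, hc⟩, fun x => (mem_reachSet_symm (h x x.2)).2.2⟩

theorem isSubtree_reachSet {G : SimpleGraph V} {A : Set V} {u : V} (hu : u ∈ A) :
    IsSubtree G (reachSet G A u) := by
  classical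
  refine isSubtree_of_forall_mem_reachSet (mem_reachSet_self hu) fun x hx => ?_
  obtain ⟨p, hp⟩ := mem_reachSet_iff_exists_walk.1 hx
  refine mem_reachSet_symm (mem_reachSet_iff_exists_walk.2 ⟨p, fun z hz => ?_⟩)
  exact mem_reachSet_iff_exists_walk.2
    ⟨p.takeUntil z hz, fun w hw => hp w (p.support_takeUntil_subset_support hz hw)⟩

theorem IsSubtree.union_singleton {G : SimpleGraph V} {U : Set V} (hU : IsSubtree G U) {u s : V}
    (hu : u ∈ U) (h : G.Adj s u) : IsSubtree G (U ∪ {s}) := by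
  refine isSubtree_of_forall_mem_reachSet (c := u) (.inl hu) ?_
  rintro x (hx | rfl)
  · exact reachSet_mono subset_union_left (hU.mem_reachSet hx hu)
  · exact mem_reachSet_of_adj (.inr rfl) (.inl hu) h

theorem IsSubtree.inter {G : SimpleGraph V} (hG : G.IsTree) {C D : Set V}
    (hC : IsSubtree G C) (hD : IsSubtree G D) (h : (C ∩ D).Nonempty) :
    IsSubtree G (C ∩ D) := by
  obtain ⟨c, hc⟩ := h
  refine isSubtree_of_forall_mem_reachSet hc fun x hx => ?_
  obtain ⟨p, hp, hpC⟩ := exists_isPath_of_mem_reachSet (hC.mem_reachSet hx.1 hc.1)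
  obtain ⟨q, hq, hqD⟩ := exists_isPath_of_mem_reachSet (hD.mem_reachSet hx.2 hc.2)
  have hpq : p = q := congrArg Subtype.val
    ((hG.isAcyclic.subsingleton_path _ _).elim ⟨p, hp⟩ ⟨q, hq⟩)
  subst hpq
  exact mem_reachSet_iff_exists_walk.2 ⟨p, fun z hz => ⟨hpC z hz, hqD z hz⟩⟩

/-- In a tree, a vertex outside a subtree has at most one neighbour in it. -/
theorem IsSubtree.eq_of_adj {G : SimpleGraph V} (hG : G.IsTree) {A : Set V}
    (hA : IsSubtree G A) {v a b : V} (hv : v ∉ A) (ha : a ∈ A) (hb : b ∈ A)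
    (hav : G.Adj a v) (hbv : G.Adj b v) : a = b := by
  by_contra hab
  obtain ⟨p, hp, hpA⟩ := exists_isPath_of_mem_reachSet (hA.mem_reachSet ha hb)
  have hq : (Walk.cons hav (Walk.cons hbv.symm Walk.nil)).IsPath := by
    simp [Walk.cons_isPath_iff, hav.ne, hbv.ne', hab]
  have h : p = _ := congrArg Subtype.val
    ((hG.isAcyclic.subsingleton_path _ _).elim ⟨p, hp⟩ ⟨_, hq⟩)
  exact hv (hpA v (by simp [h]))

/-- A walk from `A` to its complement crosses an edge leaving `A`. -/
theorem exists_adj_of_mem_reachSet {G : SimpleGraph V} {A C : Set V} {c d : V}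
    (h : d ∈ reachSet G C c) (hc : c ∈ A) (hd : d ∉ A) :
    ∃ a ∈ C ∩ A, ∃ b ∈ C \ A, G.Adj a b := by
  obtain ⟨p, hp⟩ := mem_reachSet_iff_exists_walk.1 h
  clear h
  induction p with
  | nil => exact absurd hc hd
  | @cons x y z hxy p ih =>
    by_cases hy : y ∈ A
    · exact ih hy hd fun w hw => hp w (by simp [hw])
    · exact ⟨x, ⟨hp x (by simp), hc⟩, y, ⟨hp y (by simp), hy⟩, hxy⟩

section Branch

variable {G : SimpleGraph V} {W : Set V} {u v : V}

theorem mem_branch_of_adj {a b : V} (ha : a ∈ reachSet G (W \ {v}) u) (hb : b ∈ W)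
    (hbv : b ≠ v) (h : G.Adj a b) : b ∈ reachSet G (W \ {v}) u :=
  mem_reachSet_trans ha (mem_reachSet_of_adj (reachSet_subset ha) ⟨hb, hbv⟩ h)

/-- A subtree of `W` meeting both a branch at `v` and its complement contains the edge by
which the branch is attached. -/
theorem mem_and_mem_of_crossing_branch (hG : G.IsTree) (hu : u ∈ W) (huv : G.Adj u v)
    {C : Set V} (hC : IsSubtree G C) (hCW : C ⊆ W) {c d : V} (hc : c ∈ C) (hd : d ∈ C)
    (hcA : c ∈ reachSet G (W \ {v}) u) (hdA : d ∉ reachSet G (W \ {v}) u) :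
    u ∈ C ∧ v ∈ C := by
  obtain ⟨a, ⟨haC, haA⟩, b, ⟨hbC, hbA⟩, hab⟩ :=
    exists_adj_of_mem_reachSet (hC.mem_reachSet hc hd) hcA hdA
  have hbv : b = v := by
    by_contra h
    exact hbA (mem_branch_of_adj haA (hCW hbC) h hab)
  subst hbv
  have huA : u ∈ W \ {b} := ⟨hu, huv.ne⟩
  have : a = u := (isSubtree_reachSet huA).eq_of_adj hG (fun h => (reachSet_subset h).2 rfl)
    haA (mem_reachSet_self huA) hab huv
  exact ⟨this ▸ haC, hbC⟩

theorem isSubtree_diff_branch (hW : IsSubtree G W) (hv : v ∈ W) :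
    IsSubtree G (W \ reachSet G (W \ {v}) u) := by
  have hvA : v ∉ reachSet G (W \ {v}) u := fun h => (reachSet_subset h).2 rfl
  refine isSubtree_of_forall_mem_reachSet (c := v) ⟨hv, hvA⟩ fun x hx => ?_
  by_contra hxv
  obtain ⟨a, ⟨haW, haR⟩, b, ⟨hbW, hbR⟩, hab⟩ :=
    exists_adj_of_mem_reachSet (A := reachSet G (W \ reachSet G (W \ {v}) u) x)
      (hW.mem_reachSet hx.1 hv) (mem_reachSet_self hx) hxv
  have hbA : b ∈ reachSet G (W \ {v}) u := by
    by_contra hbA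
    exact hbR (mem_reachSet_trans haR (mem_reachSet_of_adj (reachSet_subset haR) ⟨hbW, hbA⟩ hab))
  refine (reachSet_subset haR).2 (mem_branch_of_adj hbA haW ?_ hab.symm)
  rintro rfl
  exact hxv haR

end Branch

/-- Path monotonicity along a whole path: moving the sink away from `D` inside a larger
subtree does not decrease the cost. -/
theorem IsMinmaxMonotone.le_of_isPath {G : SimpleGraph V} {f : Set V → V → ℝ≥0∞}
    (hf : IsMinmaxMonotone G f) {E : Set V} (hE : IsSubtree G E) {u y : V} {p : G.Walk u y}
    (hp : p.IsPath) {D : Set V} (hD : IsSubtree G D) (hu : u ∈ D) (hDE : D ⊆ E)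
    (hpE : ∀ z ∈ p.support, z ∈ E) (hpD : ∀ z ∈ p.support, z ∈ D → z = u) :
    f D u ≤ f E y := by
  induction p generalizing D with
  | nil => exact hf.set_mono _ _ _ hD hE hu hDE
  | @cons u w y huw p ih =>
    rw [Walk.cons_isPath_iff] at hp
    have hwD : w ∉ D := fun h => huw.ne' (hpD w (by simp) h)
    refine (hf.path_mono D w u hD hwD hu huw.symm).trans
      (ih hp.1 (hD.union_singleton hu huw.symm) (.inr rfl) ?_ (fun z hz => hpE z (by simp [hz])) ?_)
    · rintro z (hz | rfl)
      · exact hDE hz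
      · exact hpE _ (by simp)
    · rintro z hz (hzD | rfl)
      · have := hpD z (by simp [hz]) hzD
        subst this
        exact absurd hz hp.2
      · rfl

theorem IsMinmaxMonotone.le_of_inter_subset {G : SimpleGraph V} {f : Set V → V → ℝ≥0∞}
    (hf : IsMinmaxMonotone G f) {D E F : Set V} (hD : IsSubtree G D) (hE : IsSubtree G E)
    (hF : IsSubtree G F) {u y : V} (hDE : D ⊆ E) (hFE : F ⊆ E) (huD : u ∈ D) (huF : u ∈ F)
    (hyF : y ∈ F) (hDF : ∀ z ∈ F, z ∈ D → z = u) : f D u ≤ f E y := by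
  obtain ⟨p, hp, hpF⟩ := exists_isPath_of_mem_reachSet (hF.mem_reachSet huF hyF)
  exact hf.le_of_isPath hE hp hD huD hDE (fun z hz => hFE (hpF z hz))
    fun z hz => hDF z (hpF z hz)

theorem IsPartialConfig.disjoint {G : SimpleGraph V} {f : Set V → V → ℝ≥0∞} {𝒯 : ℝ≥0∞}
    {W Sout A : Set V} {P : V → Set V} (h : IsPartialConfig G f 𝒯 W Sout P) (hAW : A ⊆ W)
    (hSoutA : ∀ s ∈ Sout, s ∉ A) {s : V} (hs : s ∈ Sout) : Disjoint (P s) A :=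
  disjoint_left.2 fun x hx hxA => by
    have hx' : x ∈ univ \ (W \ Sout) := h.2.2 ▸ mem_biUnion hs hx
    exact hx'.2 ⟨hAW hxA, fun h => hSoutA x h hxA⟩

theorem IsPartialConfig.insert_sink [DecidableEq V] {G : SimpleGraph V}
    {f : Set V → V → ℝ≥0∞} {𝒯 : ℝ≥0∞} {W Sout A : Set V} {P : V → Set V} {u : V}
    (h : IsPartialConfig G f 𝒯 W Sout P) (hA : IsSubtree G A) (huA : u ∈ A) (hAW : A ⊆ W)
    (hfA : f A u ≤ 𝒯) (hSoutA : ∀ s ∈ Sout, s ∉ A) :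
    IsPartialConfig G f 𝒯 ((W \ A) ∪ {u}) (Sout ∪ {u}) (Function.update P u A) := by
  have hPdisjA : ∀ s ∈ Sout, Disjoint (P s) A := fun s => h.disjoint hAW hSoutA
  obtain ⟨hPdisj, hP, hPcov⟩ := h
  have hne : ∀ s ∈ Sout, s ≠ u := fun s hs h => hSoutA u (h ▸ hs) huA
  have hP'u : Function.update P u A u = A := Function.update_self ..
  have hP' : ∀ s, s ≠ u → Function.update P u A s = P s := fun s hs =>
    Function.update_of_ne hs ..
  refine ⟨?_, ?_, ?_⟩
  · rintro s (hs | rfl) t (ht | rfl) hst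
    · rw [hP' s (hne s hs), hP' t (hne t ht)]
      exact hPdisj hs ht hst
    · rw [hP' s hst, hP'u]
      exact hPdisjA s hs
    · rw [hP' t hst.symm, hP'u]
      exact (hPdisjA t ht).symm
    · exact absurd rfl hst
  · rintro s (hs | rfl)
    · rw [hP' s (hne s hs)]
      exact hP s hs
    · rw [hP'u]
      exact ⟨hA, huA, hfA⟩
  · ext x
    have hx := Set.ext_iff.1 hPcov x
    simp only [mem_iUnion, exists_prop, mem_sdiff, mem_univ, true_and] at hx
    simp only [mem_iUnion, exists_prop, mem_sdiff, mem_univ, true_and, mem_union, mem_singleton_iff]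
    constructor
    · rintro ⟨s, hs | rfl, hxs⟩
      · rw [hP' s (hne s hs)] at hxs
        have := hx.1 ⟨s, hs, hxs⟩
        tauto
      · rw [hP'u] at hxs
        have := hSoutA x
        tauto
    · intro h
      by_cases hxA : x ∈ A
      · exact ⟨u, .inr rfl, hP'u.symm ▸ hxA⟩
      · have hxu : x ≠ u := fun h => hxA (h ▸ huA)
        obtain ⟨s, hs, hxs⟩ := hx.2 (by tauto)
        exact ⟨s, .inl hs, (hP' s (hne s hs)).symm ▸ hxs⟩

/-- Peaking Lemma: committing `V₋ᵥ(u)` to a new sink `u` (an open commit)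
keeps the partial sink configuration optimal relative to the new working tree
`(V \ V₋ᵥ(u)) ∪ {u}`. -/
theorem statement_3 [Fintype V] [DecidableEq V] (G : SimpleGraph V) (hG : G.IsTree)
    (f : Set V → V → ℝ≥0∞) (hf : IsMinmaxMonotone G f) (𝒯 : ℝ≥0∞)
    (W : Set V) (hW : IsSubtree G W)
    (Sout : Set V) (P : V → Set V)
    (hpart : IsPartialConfig G f 𝒯 W Sout P)
    (hopt : OptimalRelative G f 𝒯 W Sout P)
    (u v : V) (hpeak : PeakingPair G f 𝒯 W (Sout ∩ W) u v) :
    IsPartialConfig G f 𝒯 ((W \ reachSet G (W \ {v}) u) ∪ {u}) (Sout ∪ {u})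
      (Function.update P u (reachSet G (W \ {v}) u)) ∧
    OptimalRelative G f 𝒯 ((W \ reachSet G (W \ {v}) u) ∪ {u}) (Sout ∪ {u})
      (Function.update P u (reachSet G (W \ {v}) u)) := by
  obtain ⟨huW, hvW, huv, hSA, hfA, hfAv⟩ := hpeak
  have hP := hpart.2.1
  have huWv : u ∈ W \ {v} := ⟨huW, huv.ne⟩
  have hcross := fun {C : Set V} (hC : IsSubtree G C) (hCW : C ⊆ W) {c d : V} =>
    mem_and_mem_of_crossing_branch hG huW huv hC hCW (c := c) (d := d)
  have hstep := fun {a b : V} => mem_branch_of_adj (G := G) (W := W) (u := u) (v := v)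
    (a := a) (b := b)
  have hWA : IsSubtree G (W \ reachSet G (W \ {v}) u) := isSubtree_diff_branch hW hvW
  have hA : IsSubtree G (reachSet G (W \ {v}) u) := isSubtree_reachSet huWv
  have huA : u ∈ reachSet G (W \ {v}) u := mem_reachSet_self huWv
  have hAWv : reachSet G (W \ {v}) u ⊆ W \ {v} := reachSet_subset
  generalize reachSet G (W \ {v}) u = A at *
  have hAW : A ⊆ W := fun x hx => (hAWv hx).1
  have hvA : v ∉ A := fun h => (hAWv h).2 rfl
  have hSoutA : ∀ s ∈ Sout, s ∉ A := fun s hs hsA =>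
    (Set.ext_iff.1 hSA s).1 ⟨⟨hs, hAW hsA⟩, hsA⟩
  have huS : u ∉ Sout := fun h => hSoutA u h huA
  have hPA : ∀ s ∈ Sout, ∀ x ∈ P s, x ∉ A := fun s hs x hx hxA =>
    disjoint_left.1 (hpart.disjoint hAW hSoutA hs) hx hxA
  have hP'u : Function.update P u A u = A := Function.update_self ..
  have hP' : ∀ s, s ≠ u → Function.update P u A s = P s := fun s hs =>
    Function.update_of_ne hs ..
  have hne : ∀ s ∈ Sout, s ≠ u := fun s hs h => huS (h ▸ hs)
  refine ⟨hpart.insert_sink hA huA hAW hfA hSoutA, ?_⟩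
  obtain ⟨St, Pt, ⟨⟨hcov, hdisj, hblk⟩, hmin⟩, hSoutSt, hStW, hleaf, hout, hin, hnew⟩ := hopt
  have hself : ∀ s ∈ St, s ∈ Pt s := fun s hs =>
    ((Set.ext_iff.1 (hblk s hs).2.1 s).2 rfl).2
  have huniq : ∀ s ∈ St, ∀ t ∈ St, ∀ x, x ∈ Pt s → x ∈ Pt t → s = t :=
    fun s hs t ht x hxs hxt => by
      by_contra hst
      exact disjoint_left.1 (hdisj hs ht hst) hxs hxt
  have hexists : ∀ x, ∃ s ∈ St, x ∈ Pt s := fun x => by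
    simpa using (Set.ext_iff.1 hcov x).2 trivial
  have hPtW : ∀ s ∈ St, s ∈ W → IsSubtree G (Pt s ∩ W) := fun s hs hsW =>
    (hblk s hs).1.inter hG hW ⟨s, hself s hs, hsW⟩
  have hPtA : ∀ s ∈ St ∩ A, Pt s ⊆ W := fun s hs => hnew s hs.1 fun h => hSoutA s h hs.2
  have hPtcross : ∀ s ∈ St, s ∈ W → ∀ c ∈ Pt s, c ∈ A → ∀ d ∈ Pt s, d ∈ W → d ∉ A →
      u ∈ Pt s ∧ v ∈ Pt s := fun s hs hsW c hc hcA d hd hdW hdA =>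
    (hcross (hPtW s hs hsW) inter_subset_right ⟨hc, hAW hcA⟩ ⟨hd, hdW⟩ hcA hdA).imp
      And.left And.left
  -- A block with its sink outside `A` that meets `A` contains the edge from `u` to `v`
  have hmeet : ∀ s ∈ St, s ∉ A → ∀ c ∈ Pt s, c ∈ A → s ∈ W ∧ u ∈ Pt s ∧ v ∈ Pt s := by
    intro s hs hsA c hc hcA
    have hsW : s ∈ W := by
      by_contra hsW
      exact (Set.ext_iff.1 (hout s hs hsW).2 c).1 ⟨hc, hAW hcA⟩
    exact ⟨hsW, hPtcross s hs hsW c hc hcA s (hself s hs) hsW hsA⟩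
  have hStA : (St ∩ A).Nonempty := by
    by_contra hemp
    have hStA : ∀ s ∈ St, s ∉ A := fun s hs hsA => hemp ⟨s, hs, hsA⟩
    obtain ⟨x, hx, hux⟩ := hexists u
    obtain ⟨hxW, -, hvx⟩ := hmeet x hx (hStA x hx) u hux huA
    have hAx : A ⊆ Pt x := fun a ha => by
      obtain ⟨t, ht, hat⟩ := hexists a
      rwa [huniq x hx t ht u hux (hmeet t ht (hStA t ht) a hat ha).2.1]
    refine hfAv.not_ge (le_trans ?_ (hblk x hx).2.2)
    refine hf.le_of_inter_subset (F := Pt x ∩ (W \ A)) (hA.union_singleton huA huv.symm)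
      (hblk x hx).1 ((hblk x hx).1.inter hG hWA ⟨v, hvx, hvW, hvA⟩) ?_ inter_subset_left
      (.inr rfl) ⟨hvx, hvW, hvA⟩ ⟨hself x hx, hxW, hStA x hx⟩ ?_
    · rintro z (hz | rfl)
      · exact hAx hz
      · exact hvx
    · rintro z hz (hzA | hzv)
      · exact absurd hzA hz.2.2
      · exact hzv
  set B : Set V := A ∪ ⋃ y ∈ St ∩ A, Pt y
  have hAB : A ⊆ B := subset_union_left
  have hPtB : ∀ y ∈ St ∩ A, Pt y ⊆ B := fun y hy =>
    (subset_biUnion_of_mem (u := Pt) hy).trans subset_union_right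
  have memB : ∀ x ∈ B, x ∉ A → ∃ y ∈ St ∩ A, x ∈ Pt y := by
    rintro x (hx | hx) hxA
    · exact absurd hx hxA
    · simpa only [mem_iUnion, exists_prop] using hx
  have hBW : B ⊆ W := fun x hx => by
    by_cases hxA : x ∈ A
    · exact hAW hxA
    · obtain ⟨y, hy, hxy⟩ := memB x hx hxA
      exact hPtA y hy hxy
  have hBtree : IsSubtree G B := by
    refine isSubtree_of_forall_mem_reachSet (hAB huA) fun x hx => ?_
    by_cases hxA : x ∈ A
    · exact reachSet_mono hAB (hA.mem_reachSet hxA huA)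
    · obtain ⟨y, hy, hxy⟩ := memB x hx hxA
      exact mem_reachSet_trans
        (reachSet_mono (hPtB y hy) ((hblk y hy.1).1.mem_reachSet hxy (hself y hy.1)))
        (reachSet_mono hAB (hA.mem_reachSet hy.2 huA))
  have hBcost : f B u ≤ 𝒯 := by
    rw [hf.max_comp B u hBtree (hAB huA)]
    refine iSup₂_le fun x hx => ?_
    have hKB : reachSet G (B \ {u}) x ⊆ B \ {u} := reachSet_subset
    have hK : IsSubtree G (reachSet G (B \ {u}) x) := isSubtree_reachSet hx
    have hxK : x ∈ reachSet G (B \ {u}) x := mem_reachSet_self hx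
    have hKu : IsSubtree G (reachSet G (B \ {u}) x ∪ {u}) := by
      obtain ⟨a, ⟨haB, haK⟩, b, ⟨hbB, hbK⟩, hab⟩ :=
        exists_adj_of_mem_reachSet (A := reachSet G (B \ {u}) x)
          (hBtree.mem_reachSet hx.1 (hAB huA)) hxK fun h => (hKB h).2 rfl
      have hbu : b = u := by
        by_contra hbu
        exact hbK (mem_reachSet_trans haK (mem_reachSet_of_adj (hKB haK) ⟨hbB, hbu⟩ hab))
      exact hK.union_singleton haK (hbu ▸ hab.symm)
    generalize reachSet G (B \ {u}) x = K at *
    have hKW : K ⊆ W := fun z hz => hBW (hKB hz).1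
    have hKu' : ∀ c ∈ K, c ∈ A → ∀ d ∈ K, d ∈ A := fun c hc hcA d hd => by
      by_contra hdA
      exact (hKB (hcross hK hKW hc hd hcA hdA).1).2 rfl
    by_cases hxA : x ∈ A
    · refine (hf.set_mono _ _ _ hKu hA (.inr rfl) ?_).trans hfA
      rintro z (hz | rfl)
      · exact hKu' x hxK hxA z hz
      · exact huA
    · have hKA : ∀ z ∈ K, z ∉ A := fun z hz hzA => hxA (hKu' z hz hzA x hxK)
      obtain ⟨y, hy, hxy⟩ := memB x hx.1 hxA
      have hcr : ∀ t ∈ St ∩ A, ∀ d ∈ Pt t, d ∉ A → u ∈ Pt t := fun t ht d hd hdA =>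
        (hPtcross t ht.1 (hAW ht.2) t (hself t ht.1) ht.2 d hd (hPtA t ht hd) hdA).1
      have huy := hcr y hy x hxy hxA
      refine le_trans ?_ (hblk y hy.1).2.2
      refine hf.le_of_inter_subset (F := Pt y ∩ A) hKu (hblk y hy.1).1
        ((hblk y hy.1).1.inter hG hA ⟨u, huy, huA⟩) ?_ inter_subset_left (.inr rfl)
        ⟨huy, huA⟩ ⟨hself y hy.1, hy.2⟩ ?_
      · rintro z (hz | rfl)
        · obtain ⟨t, ht, hzt⟩ := memB z (hKB hz).1 (hKA z hz)
          rwa [huniq y hy.1 t ht.1 u huy (hcr t ht z hzt (hKA z hz))]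
        · exact huy
      · rintro z hz (hzK | hzu)
        · exact absurd hz.2 (hKA z hzK)
        · exact hzu
  have hdiff : ∀ s ∈ St, s ∉ A → IsSubtree G (Pt s \ A) := by
    intro s hs hsA
    refine isSubtree_of_forall_mem_reachSet (c := s) ⟨hself s hs, hsA⟩ fun z hz => ?_
    by_cases hsW : s ∈ W
    · by_cases hzW : z ∈ W
      · have := (hblk s hs).1.inter hG hWA ⟨s, hself s hs, hsW, hsA⟩
        exact reachSet_mono (A := Pt s ∩ (W \ A)) (B := Pt s \ A) (fun w hw => ⟨hw.1, hw.2.2⟩)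
          (this.mem_reachSet (x := z) ⟨hz.1, hzW, hz.2⟩ ⟨hself s hs, hsW, hsA⟩)
      · have hsS : s ∈ Sout := by
          by_contra hsS
          exact hzW (hnew s hs hsS hz.1)
        have hi := hin s ⟨hsS, hsW⟩
        have hzP : z ∈ P s := by
          by_contra hzP
          exact hzW (hi.2 ⟨hz.1, hzP⟩)
        exact reachSet_mono (A := P s) (B := Pt s \ A) (fun w hw => ⟨hi.1 hw, hPA s hsS w hw⟩)
          ((hP s hsS).1.mem_reachSet hzP (hP s hsS).2.1)
    · refine reachSet_mono (A := Pt s) (B := Pt s \ A) (fun w hw => ⟨hw, fun hwA => ?_⟩)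
        ((hblk s hs).1.mem_reachSet hz.1 (hself s hs))
      exact hsW (hmeet s hs hsA w hw hwA).1
  set Q : V → Set V := Function.update (fun s => Pt s \ A) u B
  have hQu : Q u = B := Function.update_self ..
  have hQne : ∀ s, s ≠ u → Q s = Pt s \ A := fun s hs => Function.update_of_ne hs ..
  have hneu : ∀ s, s ∉ A → s ≠ u := fun s hs h => hs (h ▸ huA)
  have hBdisj : ∀ s ∈ St, s ∉ A → Disjoint (Pt s \ A) B := fun s hs hsA =>
    disjoint_left.2 fun z hz hzB => by
      obtain ⟨y, hy, hzy⟩ := memB z hzB hz.2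
      exact hsA (huniq s hs y hy.1 z hz.1 hzy ▸ hy.2)
  refine ⟨(St \ A) ∪ {u}, Q, ⟨⟨?_, ?_, ?_⟩, fun St' P' h' => le_trans ?_ (hmin St' P' h')⟩,
    ?_, ?_, ?_, ?_, ?_, ?_⟩
  · refine eq_univ_of_forall fun x => ?_
    simp only [mem_iUnion, exists_prop]
    by_cases hxB : x ∈ B
    · exact ⟨u, .inr rfl, hQu.symm ▸ hxB⟩
    · obtain ⟨s, hs, hxs⟩ := hexists x
      have hsA : s ∉ A := fun hsA => hxB (hPtB s ⟨hs, hsA⟩ hxs)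
      exact ⟨s, .inl ⟨hs, hsA⟩, (hQne s (hneu s hsA)).symm ▸ ⟨hxs, fun h => hxB (hAB h)⟩⟩
  · rintro s (hs | rfl) t (ht | rfl) hst
    · rw [hQne s (hneu s hs.2), hQne t (hneu t ht.2)]
      exact (hdisj hs.1 ht.1 hst).mono sdiff_subset sdiff_subset
    · rw [hQne s hst, hQu]
      exact hBdisj s hs.1 hs.2
    · rw [hQne t hst.symm, hQu]
      exact (hBdisj t ht.1 ht.2).symm
    · exact absurd rfl hst
  · rintro s (hs | rfl)
    · rw [hQne s (hneu s hs.2)]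
      refine ⟨hdiff s hs.1 hs.2, ?_, (hf.set_mono _ _ _ (hdiff s hs.1 hs.2) (hblk s hs.1).1
        ⟨hself s hs.1, hs.2⟩ sdiff_subset).trans (hblk s hs.1).2.2⟩
      refine Subset.antisymm ?_ (singleton_subset_iff.2 ⟨.inl hs, hself s hs.1, hs.2⟩)
      rintro t ⟨ht | rfl, htP⟩
      · exact huniq t ht.1 s hs.1 t (hself t ht.1) htP.1
      · exact absurd huA htP.2
    · rw [hQu]
      refine ⟨hBtree, Subset.antisymm ?_ (singleton_subset_iff.2 ⟨.inr rfl, hAB huA⟩), hBcost⟩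
      rintro t ⟨ht | rfl, htB⟩
      · exact absurd htB (disjoint_left.1 (hBdisj t ht.1 ht.2) ⟨hself t ht.1, ht.2⟩)
      · rfl
  · obtain ⟨y, hy⟩ := hStA
    calc ((St \ A) ∪ {u}).ncard ≤ (St \ A).ncard + 1 := by
          simpa using ncard_union_le (St \ A) {u}
      _ ≤ St.ncard := ncard_lt_ncard
          ⟨sdiff_subset, fun h => (h hy.1).2 hy.2⟩ (toFinite _)
  · exact union_subset_union_left _ fun s hs => ⟨hSoutSt hs, hSoutA s hs⟩
  · ext s
    have h1 := Set.ext_iff.1 hStW s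
    have h2 := @hAW s
    have h3 := hSoutA s
    have h4 : s = u → s ∈ A := fun h => h ▸ huA
    simp only [mem_sdiff, mem_union, mem_singleton_iff] at h1 ⊢
    clear * - h1 h2 h3 h4
    tauto
  · rintro s ⟨hs | rfl, hsW'⟩
    · have hsW : s ∈ W := hsW'.elim And.left fun h => (h ▸ huW)
      obtain ⟨-, n, ⟨hnW, hsn⟩, hn⟩ := hleaf s ⟨hs, hsW⟩
      refine ⟨hsW', n, ⟨?_, hsn⟩, fun m hm => hn m ⟨hm.1.elim And.left fun h => (h ▸ huW), hm.2⟩⟩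
      by_cases hsv : s = v
      · subst hsv
        exact .inr (hn u ⟨huW, huv.symm⟩).symm
      · exact .inl ⟨hnW, fun hnA => hSoutA s hs (hstep hnA hsW hsv hsn.symm)⟩
    · refine ⟨hsW', v, ⟨.inl ⟨hvW, hvA⟩, huv⟩, ?_⟩
      rintro m ⟨hm | rfl, hum⟩
      · by_contra hmv
        exact hm.2 (hstep huA hm.1 hmv hum)
      · exact absurd rfl hum.ne
  · rintro s (hs | rfl) hsW'
    · have hsW : s ∉ W := fun h => hsW' (.inl ⟨h, hs.2⟩)
      obtain ⟨h1, h2⟩ := hout s hs.1 hsW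
      have h3 : Pt s \ A = Pt s := sdiff_eq_left.2
        ((disjoint_iff_inter_eq_empty.2 h2).mono_right hAW)
      rw [hQne s (hneu s hs.2), hP' s (hneu s hs.2), h3]
      refine ⟨h1, subset_empty_iff.1 (h2 ▸ inter_subset_inter_right _ ?_)⟩
      rintro z (hz | rfl)
      · exact hz.1
      · exact huW
    · exact absurd (.inr rfl) hsW'
  · rintro s ⟨hs | rfl, hsW'⟩
    · have hsW : s ∈ W := hsW'.elim And.left fun h => (h ▸ huW)
      obtain ⟨h1, h2⟩ := hin s ⟨hs, hsW⟩
      rw [hQne s (hne s hs), hP' s (hne s hs)]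
      exact ⟨fun z hz => ⟨h1 hz, hPA s hs z hz⟩, fun z hz => .inl ⟨h2 ⟨hz.1.1, hz.2⟩, hz.1.2⟩⟩
    · rw [hQu, hP'u]
      exact ⟨hAB, fun z hz => .inl ⟨hBW hz.1, hz.2⟩⟩
  · rintro s (hs | rfl) hsS
    · rw [hQne s (hneu s hs.2)]
      exact fun z hz => .inl ⟨hnew s hs.1 (fun h => hsS (.inl h)) hz.1, hz.2⟩
    · exact absurd (.inr rfl) hsS
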